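/- arXiv:2508.07018 — 4 statements merged into one kernel-verified Lean document; each statement's English description precedes it below -/
import Mathlib

section
/- Let n be a positive natural number, let c : (Fin n → ℝ) → ℝ be convex on all of ℝ^n, let q ∈ ℝ and d ∈ Fin n → ℝ. Then the function g(x, X) = (q − d ⬝ x) * c((q • x − X.mulVec d) / (q − d ⬝ x)) is convex on the set {(x, X) ∈ (Fin n → ℝ) × Matrix (Fin n) (Fin n) ℝ | q − d ⬝ x > 0}, where division of a vector by a positive scalar is componentwise scalar multiplication by the inverse. -/
open Matrix

/-- The inverse-scaled point of a convex combination in `ℝ × E` is a convex combination of the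
inverse-scaled points. -/
lemma inv_smul_combo_eq {E : Type*} [AddCommGroup E] [Module ℝ E] {t₁ t₂ : ℝ}
    (ht₁ : t₁ ≠ 0) (ht₂ : t₂ ≠ 0) (y₁ y₂ : E) (a b : ℝ) :
    (a * t₁ + b * t₂)⁻¹ • (a • y₁ + b • y₂) =
      (a * t₁ / (a * t₁ + b * t₂)) • t₁⁻¹ • y₁ + (b * t₂ / (a * t₁ + b * t₂)) • t₂⁻¹ • y₂ := by
  simp only [smul_add, smul_smul]
  congr 2 <;> field_simp

/-- The perspective `(t, y) ↦ t * f (y / t)` of a convex function is jointly convex for `t > 0`. -/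
theorem ConvexOn.perspective {E : Type*} [AddCommGroup E] [Module ℝ E] {s : Set E} {f : E → ℝ}
    (hf : ConvexOn ℝ s f) :
    ConvexOn ℝ {p : ℝ × E | 0 < p.1 ∧ p.1⁻¹ • p.2 ∈ s} (fun p => p.1 * f (p.1⁻¹ • p.2)) := by
  have combo_pos {t₁ t₂ a b : ℝ} (ht₁ : 0 < t₁) (ht₂ : 0 < t₂) (ha : 0 ≤ a) (hb : 0 ≤ b)
      (hab : a + b = 1) : 0 < a * t₁ + b * t₂ :=
    convex_Ioi (0 : ℝ) ht₁ ht₂ ha hb hab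
  refine ⟨?_, ?_⟩
  · rintro ⟨t₁, y₁⟩ ⟨ht₁, hy₁⟩ ⟨t₂, y₂⟩ ⟨ht₂, hy₂⟩ a b ha hb hab
    dsimp only at ht₁ ht₂ hy₁ hy₂
    have ht := combo_pos ht₁ ht₂ ha hb hab
    refine ⟨ht, ?_⟩
    simp only [Prod.smul_mk, Prod.mk_add_mk, smul_eq_mul]
    rw [inv_smul_combo_eq ht₁.ne' ht₂.ne']
    exact hf.1 hy₁ hy₂ (by positivity) (by positivity) (by rw [← add_div, div_self ht.ne'])
  · rintro ⟨t₁, y₁⟩ ⟨ht₁, hy₁⟩ ⟨t₂, y₂⟩ ⟨ht₂, hy₂⟩ a b ha hb hab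
    dsimp only at ht₁ ht₂ hy₁ hy₂
    have ht := combo_pos ht₁ ht₂ ha hb hab
    simp only [Prod.smul_mk, Prod.mk_add_mk, smul_eq_mul]
    rw [inv_smul_combo_eq ht₁.ne' ht₂.ne']
    have h := hf.2 hy₁ hy₂ (show 0 ≤ a * t₁ / (a * t₁ + b * t₂) by positivity)
      (show 0 ≤ b * t₂ / (a * t₁ + b * t₂) by positivity) (by rw [← add_div, div_self ht.ne'])
    refine (mul_le_mul_of_nonneg_left h ht.le).trans_eq ?_
    simp only [smul_eq_mul]
    field_simp

theorem perspectified_term_convexOn (n : ℕ) (hn : 0 < n)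
    (c : (Fin n → ℝ) → ℝ) (hc : ConvexOn ℝ (Set.univ : Set (Fin n → ℝ)) c)
    (q : ℝ) (d : Fin n → ℝ) :
    ConvexOn ℝ {p : (Fin n → ℝ) × Matrix (Fin n) (Fin n) ℝ | 0 < q - d ⬝ᵥ p.1}
      (fun p : (Fin n → ℝ) × Matrix (Fin n) (Fin n) ℝ =>
        (q - d ⬝ᵥ p.1) * c ((q - d ⬝ᵥ p.1)⁻¹ • (q • p.1 - p.2.mulVec d))) := by
  let L : (Fin n → ℝ) × Matrix (Fin n) (Fin n) ℝ →ₗ[ℝ] ℝ × (Fin n → ℝ) :=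
    { toFun := fun p => (-(d ⬝ᵥ p.1), q • p.1 - p.2.mulVec d)
      map_add' := fun p r => by
        ext <;> simp [dotProduct_add, add_mulVec] <;> ring
      map_smul' := fun a p => by
        ext <;> simp [dotProduct_smul, smul_mulVec] <;> ring }
  let A := L.toAffineMap + AffineMap.const ℝ _ ((q, 0) : ℝ × (Fin n → ℝ))
  have hA (p : (Fin n → ℝ) × Matrix (Fin n) (Fin n) ℝ) :
      A p = (q - d ⬝ᵥ p.1, q • p.1 - p.2.mulVec d) := by
    simp [A, L, neg_add_eq_sub]
  simpa [Set.preimage, Function.comp_def, hA] using hc.perspective.comp_affineMap A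
end

section
/- Let n be a positive natural number, let c₀ : (Fin n → ℝ) → ℝ, let a ∈ Fin n → ℝ, b ∈ ℝ, τ ∈ ℝ, and let x ∈ Fin n → ℝ satisfy c₀(x) ≤ τ and b − a ⬝ x > 0. Set X = vecMulVec x x and v = τ • x (so that v plays the role of the linearization of x τ). Then (b − a ⬝ x) * c₀((b • x − X.mulVec a)/(b − a ⬝ x)) ≤ b * τ − a ⬝ v. -/
open Matrix

theorem perspectified_epigraph_valid (n : ℕ) (hn : 0 < n)
    (c₀ : (Fin n → ℝ) → ℝ) (a : Fin n → ℝ) (b τ : ℝ)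
    (x : Fin n → ℝ) (hc : c₀ x ≤ τ) (hax : 0 < b - a ⬝ᵥ x)
    (X : Matrix (Fin n) (Fin n) ℝ) (hX : X = vecMulVec x x)
    (v : Fin n → ℝ) (hv : v = τ • x) :
    (b - a ⬝ᵥ x) * c₀ ((b - a ⬝ᵥ x)⁻¹ • (b • x - X.mulVec a)) ≤ b * τ - a ⬝ᵥ v := by
  subst hX hv
  have hpersp : b • x - (vecMulVec x x).mulVec a = (b - a ⬝ᵥ x) • x := by
    ext i
    simp [vecMulVec_mulVec, dotProduct_comm x a]
    ring
  rw [hpersp, inv_smul_smul₀ hax.ne', dotProduct_smul, smul_eq_mul]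
  calc (b - a ⬝ᵥ x) * c₀ x ≤ (b - a ⬝ᵥ x) * τ := mul_le_mul_of_nonneg_left hc hax.le
    _ = b * τ - τ * a ⬝ᵥ x := by ring
end

section
/- Let n be a positive natural number, let K ⊆ (Fin n → ℝ) be a compact convex set, let f : (Fin n → ℝ) → ℝ be continuous on K, and let ε > 0. Then there exist functions g, h : (Fin n → ℝ) → ℝ with g convex on K and h convex on K such that |f x − (g x − h x)| ≤ ε for all x ∈ K. -/
/-- The continuous functions on `K` that are a difference of two convex functions. -/
def convexDifferences {E : Type*} [TopologicalSpace E] [AddCommGroup E] [Module ℝ E]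
    (K : Set E) : Set C(K, ℝ) :=
  {φ | ∃ g h : E → ℝ, ConvexOn ℝ K g ∧ ConvexOn ℝ K h ∧ ∀ x : K, φ x = g x - h x}

section ConvexDifferences

variable {E : Type*} [TopologicalSpace E] [AddCommGroup E] [Module ℝ E] {K : Set E}

lemma sup_mem_convexDifferences {φ ψ : C(K, ℝ)} (hφ : φ ∈ convexDifferences K)
    (hψ : ψ ∈ convexDifferences K) : φ ⊔ ψ ∈ convexDifferences K := by
  obtain ⟨g₁, h₁, hg₁, hh₁, e₁⟩ := hφ
  obtain ⟨g₂, h₂, hg₂, hh₂, e₂⟩ := hψ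
  refine ⟨(g₁ + h₂) ⊔ (g₂ + h₁), h₁ + h₂, (hg₁.add hh₂).sup (hg₂.add hh₁), hh₁.add hh₂,
    fun x ↦ ?_⟩
  simp only [ContinuousMap.sup_apply, e₁, e₂, Pi.sup_apply, Pi.add_apply, ← max_sub_sub_right]
  congr 1 <;> ring

lemma neg_mem_convexDifferences {φ : C(K, ℝ)} (hφ : φ ∈ convexDifferences K) :
    -φ ∈ convexDifferences K := by
  obtain ⟨g, h, hg, hh, e⟩ := hφ
  exact ⟨h, g, hh, hg, fun x ↦ by simp [e]⟩

lemma inf_mem_convexDifferences {φ ψ : C(K, ℝ)} (hφ : φ ∈ convexDifferences K)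
    (hψ : ψ ∈ convexDifferences K) : φ ⊓ ψ ∈ convexDifferences K := by
  have key := neg_mem_convexDifferences (sup_mem_convexDifferences
    (neg_mem_convexDifferences hφ) (neg_mem_convexDifferences hψ))
  rwa [neg_sup, neg_neg, neg_neg] at key

lemma affine_mem_convexDifferences (hK : Convex ℝ K) (l : E →L[ℝ] ℝ) (c : ℝ) :
    (⟨fun x : K ↦ l x + c, by fun_prop⟩ : C(K, ℝ)) ∈ convexDifferences K :=
  ⟨fun x ↦ l x + c, 0, (l.toLinearMap.convexOn hK).add_const c, convexOn_const 0 hK,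
    fun x ↦ by simp⟩

lemma separatesPointsStrongly_convexDifferences [SeparatingDual ℝ E] (hK : Convex ℝ K) :
    (convexDifferences K).SeparatesPointsStrongly := by
  intro v x y
  by_cases hxy : x = y
  · subst hxy
    exact ⟨_, affine_mem_convexDifferences hK 0 (v x), by simp, by simp⟩
  · obtain ⟨l, hl⟩ := SeparatingDual.exists_separating_of_ne (R := ℝ) (Subtype.coe_ne_coe.2 hxy)
    have hne : l y - l x ≠ 0 := sub_ne_zero.2 hl.symm
    refine ⟨_, affine_mem_convexDifferences hK (((v y - v x) / (l y - l x)) • l)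
      (v x - (v y - v x) / (l y - l x) * l x), by simp, ?_⟩
    simp only [ContinuousMap.coe_mk, smul_apply, smul_eq_mul]
    field_simp
    ring

lemma closure_convexDifferences [SeparatingDual ℝ E] (hKc : IsCompact K) (hK : Convex ℝ K) :
    closure (convexDifferences K) = ⊤ := by
  have : CompactSpace K := isCompact_iff_compactSpace.1 hKc
  exact ContinuousMap.sublattice_closure_eq_top _ ⟨_, affine_mem_convexDifferences hK 0 0⟩
    (fun _ hφ _ hψ ↦ inf_mem_convexDifferences hφ hψ)
    (fun _ hφ _ hψ ↦ sup_mem_convexDifferences hφ hψ)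
    (separatesPointsStrongly_convexDifferences hK)

end ConvexDifferences

theorem dc_approximation_of_continuous (n : ℕ) (hn : 0 < n)
    (K : Set (Fin n → ℝ)) (hKc : IsCompact K) (hKconv : Convex ℝ K)
    (f : (Fin n → ℝ) → ℝ) (hf : ContinuousOn f K) (ε : ℝ) (hε : 0 < ε) :
    ∃ g h : (Fin n → ℝ) → ℝ, ConvexOn ℝ K g ∧ ConvexOn ℝ K h ∧
      ∀ x ∈ K, |f x - (g x - h x)| ≤ ε := by
  have : CompactSpace K := isCompact_iff_compactSpace.1 hKc
  let F : C(K, ℝ) := ⟨K.domRestrict f, hf.domRestrict⟩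
  have hF : F ∈ closure (convexDifferences K) := by
    rw [closure_convexDifferences hKc hKconv]
    trivial
  obtain ⟨φ, ⟨g, h, hg, hh, e⟩, hφ⟩ := Metric.mem_closure_iff.1 hF ε hε
  refine ⟨g, h, hg, hh, fun x hx ↦ ?_⟩
  have hdist := (ContinuousMap.dist_apply_le_dist (f := F) (g := φ) ⟨x, hx⟩).trans hφ.le
  rwa [Real.dist_eq, e] at hdist
end

section
/- Let n be a positive natural number, let K ⊆ (Fin n → ℝ) be a compact convex set, and let f : (Fin n → ℝ) → ℝ be twice continuously differentiable (ContDiff ℝ 2 f). Then there exist functions g, h : (Fin n → ℝ) → ℝ with g convex on K and h convex on K such that f x = g x − h x for all x ∈ K. -/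
theorem Convex.convexOn_of_forall_exists_affine_le {E : Type*} [AddCommGroup E] [Module ℝ E]
    {s : Set E} (hs : Convex ℝ s) {g : E → ℝ}
    (hg : ∀ z ∈ s, ∃ l : E →ₗ[ℝ] ℝ, ∀ x ∈ s, g z + l (x - z) ≤ g x) : ConvexOn ℝ s g := by
  refine ⟨hs, fun x hx y hy a b ha hb hab => ?_⟩
  obtain ⟨l, hl⟩ := hg _ (hs hx hy ha hb hab)
  have hx' := mul_le_mul_of_nonneg_left (hl x hx) ha
  have hy' := mul_le_mul_of_nonneg_left (hl y hy) hb
  simp only [map_sub, map_add, map_smul, smul_eq_mul] at hx' hy' ⊢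
  obtain rfl : b = 1 - a := by linarith
  linarith

theorem norm_sq_le_dotProduct_self {ι : Type*} [Fintype ι] (v : ι → ℝ) : ‖v‖ ^ 2 ≤ v ⬝ᵥ v := by
  have h0 : 0 ≤ v ⬝ᵥ v := Finset.sum_nonneg fun i _ => mul_self_nonneg (v i)
  refine (Real.le_sqrt (norm_nonneg v) h0).1 <|
    (pi_norm_le_iff_of_nonneg (Real.sqrt_nonneg _)).2 fun i => Real.abs_le_sqrt ?_
  rw [sq]
  exact Finset.single_le_sum (f := fun j => v j * v j) (fun j _ => mul_self_nonneg (v j))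
    (Finset.mem_univ i)

theorem dotProduct_self_eq_add_dotProduct_sub {ι : Type*} [Fintype ι] (x z : ι → ℝ) :
    x ⬝ᵥ x = z ⬝ᵥ z + 2 * (z ⬝ᵥ (x - z)) + (x - z) ⬝ᵥ (x - z) := by
  simp only [dotProduct_sub, sub_dotProduct, dotProduct_comm z x]
  ring

/-- The first-order Taylor remainder bound for a function with Lipschitz derivative. -/
theorem LipschitzOnWith.norm_sub_sub_fderiv_le {E F : Type*} [NormedAddCommGroup E]
    [NormedSpace ℝ E] [NormedAddCommGroup F] [NormedSpace ℝ F] {f : E → F} {s : Set E} {L : NNReal}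
    (hL : LipschitzOnWith L (fderiv ℝ f) s) (hs : Convex ℝ s)
    (hf : ∀ x ∈ s, DifferentiableAt ℝ f x) {z x : E} (hz : z ∈ s) (hx : x ∈ s) :
    ‖f x - f z - fderiv ℝ f z (x - z)‖ ≤ L * ‖x - z‖ ^ 2 := by
  have key := Convex.norm_image_sub_le_of_norm_fderiv_le' (𝕜 := ℝ) (f := f) (φ := fderiv ℝ f z)
    (s := s ∩ Metric.closedBall z ‖x - z‖) (C := L * ‖x - z‖) (x := z) (y := x)
    (fun w hw => hf w hw.1)
    (fun w hw => (hL.norm_sub_le hw.1 hz).trans <| by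
      have := mem_closedBall_iff_norm.1 hw.2
      gcongr)
    (hs.inter (convex_closedBall _ _)) ⟨hz, Metric.mem_closedBall_self (norm_nonneg _)⟩
    ⟨hx, mem_closedBall_iff_norm.2 le_rfl⟩
  linarith

theorem hartman_dc_decomposition (n : ℕ) (hn : 0 < n)
    (K : Set (Fin n → ℝ)) (hKc : IsCompact K) (hKconv : Convex ℝ K)
    (f : (Fin n → ℝ) → ℝ) (hf : ContDiff ℝ 2 f) :
    ∃ g h : (Fin n → ℝ) → ℝ, ConvexOn ℝ K g ∧ ConvexOn ℝ K h ∧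
      ∀ x ∈ K, f x = g x - h x := by
  obtain ⟨L, hL⟩ := (hf.fderiv_right (m := 1) (by norm_num)).contDiffOn.exists_lipschitzOnWith
    one_ne_zero hKconv hKc
  refine ⟨fun x => f x + L * (x ⬝ᵥ x), fun x => L * (x ⬝ᵥ x),
    hKconv.convexOn_of_forall_exists_affine_le fun z hz =>
      ⟨fderiv ℝ f z + (2 * (L : ℝ)) • dotProductBilin ℝ ℝ z, fun x hx => ?_⟩,
    hKconv.convexOn_of_forall_exists_affine_le fun z _ =>
      ⟨(2 * (L : ℝ)) • dotProductBilin ℝ ℝ z, fun x _ => ?_⟩,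
    fun x _ => (add_sub_cancel_right _ _).symm⟩
  · have taylor := neg_le_of_abs_le <| hL.norm_sub_sub_fderiv_le hKconv
      (fun w _ => hf.differentiable two_ne_zero w) hz hx
    have hnorm := mul_le_mul_of_nonneg_left (norm_sq_le_dotProduct_self (x - z)) L.coe_nonneg
    change f z + L * (z ⬝ᵥ z) + (fderiv ℝ f z (x - z) + 2 * L * (z ⬝ᵥ (x - z))) ≤ _
    rw [dotProduct_self_eq_add_dotProduct_sub x z]
    linarith
  · have hnonneg := mul_nonneg L.coe_nonneg <|
      (sq_nonneg ‖x - z‖).trans (norm_sq_le_dotProduct_self (x - z))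
    change L * (z ⬝ᵥ z) + 2 * L * (z ⬝ᵥ (x - z)) ≤ _
    rw [dotProduct_self_eq_add_dotProduct_sub x z]
    linarith
end
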